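/- arXiv:2601.22568 — 2 statements merged into one kernel-verified Lean document; each statement's English description precedes it below -/
import Mathlib

section
/- Let q ≥ 1 and qs ≥ 1, and define F_{q,s}(σ) = 1 − (Tr σ^q)^s for a density matrix σ. Let ρ_{AB} be a density matrix indexed by (A × B) × (A × B) for finite index types A, B, with partial traces ρ_A and ρ_B. Then |F_{q,s}(ρ_A) − F_{q,s}(ρ_B)| ≤ F_{q,s}(ρ_{AB}) ≤ F_{q,s}(ρ_A) + F_{q,s}(ρ_B). -/
open scoped ComplexOrder

/-- `Tr σ^r := Σ_i μ_i^r` where `μ_i` are the eigenvalues of the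
(Hermitian) matrix `σ`, with real powers. -/
noncomputable def trRpow {n : Type*} [Fintype n] (ρ : Matrix n n ℂ) (r : ℝ) : ℝ :=
  letI := Classical.decEq n
  letI := Classical.dec ρ.IsHermitian
  if h : ρ.IsHermitian then ∑ i, h.eigenvalues i ^ r else 0

/-- The partial trace over the second factor. -/
noncomputable def ptraceRight {A B : Type*} [Fintype B]
    (ρ : Matrix (A × B) (A × B) ℂ) : Matrix A A ℂ :=
  fun i i' => ∑ j, ρ (i, j) (i', j)

/-- The partial trace over the first factor. -/
noncomputable def ptraceLeft {A B : Type*} [Fintype A]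
    (ρ : Matrix (A × B) (A × B) ℂ) : Matrix B B ℂ :=
  fun j j' => ∑ i, ρ (i, j) (i, j')

open scoped Kronecker MatrixOrder

section Scalar

/-- The dual-norm weight attaining `‖a‖_p` in Hölder's inequality. -/
lemma exists_dual_weight {I : Type*} [Fintype I] {p p' : ℝ} (hp : p.HolderConjugate p')
    (a : I → ℝ) (ha : ∀ i, 0 ≤ a i) :
    ∃ x : I → ℝ, (∀ i, 0 ≤ x i) ∧ (∀ i, x i ≤ 1) ∧ ∑ i, x i ^ p' ≤ 1 ∧
      ∑ i, x i * a i = (∑ i, a i ^ p) ^ (1 / p) := by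
  suffices h : ∃ x : I → ℝ, (∀ i, 0 ≤ x i) ∧ ∑ i, x i ^ p' ≤ 1 ∧
      ∑ i, x i * a i = (∑ i, a i ^ p) ^ (1 / p) by
    obtain ⟨x, hx0, hx1, hx⟩ := h
    refine ⟨x, hx0, fun i => ?_, hx1, hx⟩
    by_contra! hi
    have h1 := Real.one_lt_rpow hi hp.symm.pos
    have h2 := Finset.single_le_sum (f := fun i => x i ^ p')
      (fun j _ => Real.rpow_nonneg (hx0 j) _) (Finset.mem_univ i)
    linarith
  have hS : 0 ≤ ∑ i, a i ^ p := Finset.sum_nonneg fun i _ => Real.rpow_nonneg (ha i) _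
  have hN0 : 0 ≤ (∑ i, a i ^ p) ^ (1 / p) := Real.rpow_nonneg hS _
  have hNp : ((∑ i, a i ^ p) ^ (1 / p)) ^ p = ∑ i, a i ^ p := by
    rw [one_div, Real.rpow_inv_rpow hS hp.ne_zero]
  set N := (∑ i, a i ^ p) ^ (1 / p) with hN
  rcases hN0.eq_or_lt with h0 | hpos
  · refine ⟨fun _ => 0, fun _ => le_rfl, ?_, ?_⟩
    · simp [Real.zero_rpow hp.symm.ne_zero]
    · simp [← h0]
  have hsum : ∑ i, (a i / N) ^ p = 1 := by
    simp_rw [Real.div_rpow (ha _) hN0]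
    rw [← Finset.sum_div, ← hNp, div_self (Real.rpow_pos_of_pos hpos _).ne']
  have hd : ∀ i, 0 ≤ a i / N := fun i => div_nonneg (ha i) hN0
  refine ⟨fun i => (a i / N) ^ (p - 1), fun i => Real.rpow_nonneg (hd i) _, ?_, ?_⟩
  · simp_rw [← Real.rpow_mul (hd _), hp.sub_one_mul_conj]
    exact hsum.le
  · have : ∀ i, (a i / N) ^ (p - 1) * a i = (a i / N) ^ p * N := fun i => by
      have h1 : a i = a i / N * N := by field_simp
      conv_lhs => rw [h1]
      rw [← mul_assoc, mul_div_cancel_right₀ _ hpos.ne']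
      congr 1
      conv_lhs => rw [← Real.rpow_add_one' (hd i) (by simpa using hp.ne_zero)]
      simp
    simp_rw [this]
    rw [← Finset.sum_mul, hsum, one_mul]

/-- Subadditivity of `1 - ‖·‖_q` for a joint probability distribution and its marginals. -/
lemma lpNorm_marginals_add_le {I J : Type*} [Fintype I] [Fintype J] {q : ℝ} (hq : 1 ≤ q)
    (P : I × J → ℝ) (hP : ∀ k, 0 ≤ P k) (hsum : ∑ k, P k = 1) :
    (∑ i, (∑ j, P (i, j)) ^ q) ^ (1 / q) + (∑ j, (∑ i, P (i, j)) ^ q) ^ (1 / q) ≤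
      1 + (∑ k, P k ^ q) ^ (1 / q) := by
  have hsum' : ∑ i, ∑ j, P (i, j) = 1 := by rw [← Fintype.sum_prod_type, hsum]
  rcases hq.eq_or_lt with rfl | hq
  · simp only [Real.rpow_one, div_one, hsum, hsum']
    rw [Finset.sum_comm, hsum']
  have hc := Real.HolderConjugate.conjExponent hq
  set q' := q.conjExponent
  obtain ⟨x, hx0, hx1, hxq, hx⟩ := exists_dual_weight hc (fun i => ∑ j, P (i, j))
    fun i => Finset.sum_nonneg fun j _ => hP _
  obtain ⟨y, hy0, hy1, hyq, hy⟩ := exists_dual_weight hc (fun j => ∑ i, P (i, j))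
    fun i => Finset.sum_nonneg fun j _ => hP _
  rw [← hx, ← hy]
  have hH := Real.inner_le_Lp_mul_Lq_of_nonneg Finset.univ (f := P)
    (g := fun k => x k.1 * y k.2) hc (fun k _ => hP k)
    (fun k _ => mul_nonneg (hx0 _) (hy0 _))
  have hxy : (∑ k : I × J, (x k.1 * y k.2) ^ q') ^ (1 / q') ≤ 1 := by
    refine Real.rpow_le_one ?_ ?_ (one_div_nonneg.2 hc.symm.nonneg)
    · exact Finset.sum_nonneg fun k _ => Real.rpow_nonneg (mul_nonneg (hx0 _) (hy0 _)) _
    · simp_rw [Real.mul_rpow (hx0 _) (hy0 _), Fintype.sum_prod_type, ← Finset.mul_sum,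
        ← Finset.sum_mul]
      exact mul_le_one₀ hxq (Finset.sum_nonneg fun j _ => Real.rpow_nonneg (hy0 j) _) hyq
  have hle : ∑ k, P k * (x k.1 * y k.2) ≤ (∑ k, P k ^ q) ^ (1 / q) :=
    hH.trans (mul_le_of_le_one_right
      (Real.rpow_nonneg (Finset.sum_nonneg fun k _ => Real.rpow_nonneg (hP k) _) _) hxy)
  have hX : ∑ i, x i * ∑ j, P (i, j) = ∑ k : I × J, P k * x k.1 := by
    simp_rw [Fintype.sum_prod_type, Finset.mul_sum, mul_comm]
  have hY : ∑ j, y j * ∑ i, P (i, j) = ∑ k : I × J, P k * y k.2 := by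
    simp_rw [Fintype.sum_prod_type_right, Finset.mul_sum, mul_comm]
  rw [hX, hY, ← Finset.sum_add_distrib]
  refine le_trans ?_ (add_le_add hsum.le hle)
  rw [← Finset.sum_add_distrib]
  refine Finset.sum_le_sum fun k _ => ?_
  nlinarith [mul_nonneg (hP k) (mul_nonneg (sub_nonneg.2 (hx1 k.1)) (sub_nonneg.2 (hy1 k.2)))]

lemma rpow_add_rpow_le_one_add_rpow {x y z t : ℝ} (ht : 1 ≤ t) (hx0 : 0 ≤ x) (hx1 : x ≤ 1)
    (hy0 : 0 ≤ y) (hy1 : y ≤ 1) (hz : 0 ≤ z) (h : x + y ≤ 1 + z) :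
    x ^ t + y ^ t ≤ 1 + z ^ t := by
  have ht0 : 0 ≤ t := by linarith
  rcases le_total (x + y) 1 with hxy | hxy
  · have h1 := Real.rpow_le_self_of_le_one hx0 hx1 ht
    have h2 := Real.rpow_le_self_of_le_one hy0 hy1 ht
    linarith [Real.rpow_nonneg hz t]
  rcases hy1.eq_or_lt with rfl | hy1
  · linarith [Real.rpow_le_rpow hx0 (by linarith : x ≤ z) ht0, Real.one_rpow t]
  have hd : 0 < 2 - x - y := by linarith
  have hw : 0 ≤ x + y - 1 := by linarith
  have ha : 0 ≤ (1 - y) / (2 - x - y) := div_nonneg (by linarith) hd.le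
  have hb : 0 ≤ (1 - x) / (2 - x - y) := div_nonneg (by linarith) hd.le
  have hab : (1 - y) / (2 - x - y) + (1 - x) / (2 - x - y) = 1 := by field_simp; ring
  have hconv := (convexOn_rpow ht).2
  have h1 := hconv (Set.mem_Ici.2 zero_le_one) (Set.mem_Ici.2 hw) ha hb hab
  have h2 := hconv (Set.mem_Ici.2 hw) (Set.mem_Ici.2 zero_le_one) ha hb hab
  have e1 : (1 - y) / (2 - x - y) * 1 + (1 - x) / (2 - x - y) * (x + y - 1) = x := by
    field_simp; ring
  have e2 : (1 - y) / (2 - x - y) * (x + y - 1) + (1 - x) / (2 - x - y) * 1 = y := by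
    field_simp; ring
  simp only [smul_eq_mul, e1, e2, Real.one_rpow] at h1 h2
  have h3 : (x + y - 1) ^ t ≤ z ^ t := Real.rpow_le_rpow hw (by linarith) ht0
  have h4 : (1 - y) / (2 - x - y) * (x + y - 1) ^ t + (1 - x) / (2 - x - y) * (x + y - 1) ^ t
      = (x + y - 1) ^ t := by rw [← add_mul, hab, one_mul]
  linarith

end Scalar

section TrRpow

variable {m n : Type*} [Fintype m] [Fintype n]

lemma trRpow_eq_sum_eigenvalues [DecidableEq n] {σ : Matrix n n ℂ} (h : σ.IsHermitian) (r : ℝ) :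
    trRpow σ r = ∑ i, h.eigenvalues i ^ r := by
  unfold trRpow
  rw [dif_pos h]
  congr!

lemma trRpow_eq_sum_roots [DecidableEq n] {σ : Matrix n n ℂ} (h : σ.IsHermitian) (r : ℝ) :
    trRpow σ r = (σ.charpoly.roots.map fun z => z.re ^ r).sum := by
  rw [trRpow_eq_sum_eigenvalues h, h.roots_charpoly_eq_eigenvalues]
  simp

lemma trRpow_transpose {σ : Matrix n n ℂ} (h : σ.IsHermitian) (r : ℝ) :
    trRpow σ.transpose r = trRpow σ r := by
  classical
  rw [trRpow_eq_sum_roots h.transpose, trRpow_eq_sum_roots h, Matrix.charpoly_transpose]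

lemma trRpow_reindex (e : m ≃ n) {σ : Matrix m m ℂ} (h : σ.IsHermitian) (r : ℝ) :
    trRpow (Matrix.reindex e e σ) r = trRpow σ r := by
  classical
  have h' : (Matrix.reindex e e σ).IsHermitian := h.submatrix _
  rw [trRpow_eq_sum_roots h', trRpow_eq_sum_roots h, Matrix.charpoly_reindex]

lemma trRpow_mul_conjTranspose (M : Matrix m n ℂ) {r : ℝ} (hr : r ≠ 0) :
    trRpow (M * M.conjTranspose) r = trRpow (M.conjTranspose * M) r := by
  classical
  rw [trRpow_eq_sum_roots (Matrix.isHermitian_mul_conjTranspose_self M),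
    trRpow_eq_sum_roots (Matrix.isHermitian_conjTranspose_mul_self M)]
  have h := congrArg Polynomial.roots (Matrix.charpoly_mul_comm' M M.conjTranspose)
  rw [Polynomial.roots_mul (mul_ne_zero (pow_ne_zero _ Polynomial.X_ne_zero)
      (Matrix.charpoly_monic _).ne_zero),
    Polynomial.roots_mul (mul_ne_zero (pow_ne_zero _ Polynomial.X_ne_zero)
      (Matrix.charpoly_monic _).ne_zero), Polynomial.roots_X_pow, Polynomial.roots_X_pow] at h
  simpa [Multiset.map_nsmul, Multiset.sum_nsmul, Real.zero_rpow hr] using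
    congrArg (fun s => (s.map fun z : ℂ => z.re ^ r).sum) h

lemma trRpow_unitary_conj [DecidableEq n] {σ : Matrix n n ℂ} (h : σ.IsHermitian)
    {U : Matrix n n ℂ} (hU : U * U.conjTranspose = 1) (r : ℝ) :
    trRpow (U.conjTranspose * σ * U) r = trRpow σ r := by
  rw [trRpow_eq_sum_roots (Matrix.isHermitian_conjTranspose_mul_mul U h),
    trRpow_eq_sum_roots h, Matrix.charpoly_mul_comm, ← mul_assoc, hU, one_mul]

lemma trRpow_nonneg {σ : Matrix n n ℂ} (h : σ.PosSemidef) (r : ℝ) : 0 ≤ trRpow σ r := by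
  classical
  rw [trRpow_eq_sum_eigenvalues h.isHermitian]
  exact Finset.sum_nonneg fun i _ => Real.rpow_nonneg (h.eigenvalues_nonneg i) _

lemma trRpow_le_one {σ : Matrix n n ℂ} (h : σ.PosSemidef) (htr : σ.trace = 1) {r : ℝ}
    (hr : 1 ≤ r) : trRpow σ r ≤ 1 := by
  classical
  have hs : ∑ i, h.isHermitian.eigenvalues i = 1 := by
    simpa [htr] using (congrArg Complex.re h.isHermitian.trace_eq_sum_eigenvalues).symm
  rw [trRpow_eq_sum_eigenvalues h.isHermitian, ← hs]
  refine Finset.sum_le_sum fun i _ =>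
    Real.rpow_le_self_of_le_one (h.eigenvalues_nonneg i) ?_ hr
  rw [← hs]
  exact Finset.single_le_sum (fun j _ => h.eigenvalues_nonneg j) (Finset.mem_univ i)

/-- Peierls' inequality for the power function: pinching to the diagonal decreases `Tr σ^r`. -/
lemma sum_diag_rpow_le_trRpow {σ : Matrix n n ℂ} (h : σ.PosSemidef) {r : ℝ} (hr : 1 ≤ r) :
    ∑ k, (σ k k).re ^ r ≤ trRpow σ r := by
  classical
  rw [trRpow_eq_sum_eigenvalues h.isHermitian]
  set lam := h.isHermitian.eigenvalues
  set U : Matrix n n ℂ := h.isHermitian.eigenvectorUnitary.1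
  have hUU : U * star U = 1 := Unitary.coe_mul_star_self h.isHermitian.eigenvectorUnitary
  have hUU' : star U * U = 1 := Unitary.coe_star_mul_self h.isHermitian.eigenvectorUnitary
  have hrow : ∀ k, ∑ l, Complex.normSq (U k l) = 1 := fun k => by
    have := congrFun (congrFun hUU k) k
    simp only [Matrix.mul_apply, Matrix.star_apply, Matrix.one_apply_eq, RCLike.star_def,
      Complex.mul_conj] at this
    exact_mod_cast this
  have hcol : ∀ l, ∑ k, Complex.normSq (U k l) = 1 := fun l => by
    have := congrFun (congrFun hUU' l) l
    simp only [Matrix.mul_apply, Matrix.star_apply, Matrix.one_apply_eq, RCLike.star_def,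
      mul_comm, Complex.mul_conj] at this
    exact_mod_cast this
  have hdiag : ∀ k, (σ k k).re = ∑ l, Complex.normSq (U k l) * lam l := fun k => by
    have hspec : σ = U * Matrix.diagonal (fun i => (lam i : ℂ)) * star U := by
      conv_lhs => rw [h.isHermitian.spectral_theorem, Unitary.conjStarAlgAut_apply]
      rfl
    have : σ k k = ((∑ l, Complex.normSq (U k l) * lam l : ℝ) : ℂ) := by
      conv_lhs => rw [hspec]
      rw [Matrix.mul_apply]
      push_cast
      refine Finset.sum_congr rfl fun l _ => ?_
      rw [Matrix.mul_diagonal, Matrix.star_apply, RCLike.star_def, ← Complex.mul_conj]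
      ring
    rw [this, Complex.ofReal_re]
  calc ∑ k, (σ k k).re ^ r ≤ ∑ k, ∑ l, Complex.normSq (U k l) * lam l ^ r := by
        refine Finset.sum_le_sum fun k _ => ?_
        rw [hdiag]
        exact Real.rpow_arith_mean_le_arith_mean_rpow _ _ _ (fun l _ => Complex.normSq_nonneg _)
          (hrow k) (fun l _ => h.eigenvalues_nonneg l) hr
    _ = ∑ l, lam l ^ r := by
        rw [Finset.sum_comm]
        simp_rw [← Finset.sum_mul, hcol, one_mul]

end TrRpow

section PartialTrace

variable {A B : Type*}

lemma trace_ptraceRight [Fintype A] [Fintype B]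
    (ρ : Matrix (A × B) (A × B) ℂ) : (ptraceRight ρ).trace = ρ.trace := by
  simp [ptraceRight, Matrix.trace, Fintype.sum_prod_type]

lemma trace_ptraceLeft [Fintype A] [Fintype B]
    (ρ : Matrix (A × B) (A × B) ℂ) : (ptraceLeft ρ).trace = ρ.trace := by
  simp [ptraceLeft, Matrix.trace, Fintype.sum_prod_type_right]

lemma ptraceLeft_eq_ptraceRight [Fintype A] (ρ : Matrix (A × B) (A × B) ℂ) :
    ptraceLeft ρ = ptraceRight (Matrix.reindex (Equiv.prodComm A B) (Equiv.prodComm A B) ρ) :=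
  rfl

lemma posSemidef_ptraceRight [Fintype B] {ρ : Matrix (A × B) (A × B) ℂ} (h : ρ.PosSemidef) :
    (ptraceRight ρ).PosSemidef := by
  have : ptraceRight ρ = ∑ j, ρ.submatrix (fun i => (i, j)) (fun i => (i, j)) := by
    ext i i'
    simp [ptraceRight, Matrix.sum_apply]
  rw [this]
  exact Matrix.posSemidef_sum _ fun j _ => h.submatrix _

lemma posSemidef_ptraceLeft [Fintype A] {ρ : Matrix (A × B) (A × B) ℂ} (h : ρ.PosSemidef) :
    (ptraceLeft ρ).PosSemidef := by
  rw [ptraceLeft_eq_ptraceRight]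
  exact posSemidef_ptraceRight (h.submatrix _)

lemma ptraceRight_kronecker_conj [Fintype A] [Fintype B] [DecidableEq B]
    (ρ : Matrix (A × B) (A × B) ℂ)
    (U : Matrix A A ℂ) {V : Matrix B B ℂ} (hV : V * V.conjTranspose = 1) :
    ptraceRight ((U ⊗ₖ V).conjTranspose * ρ * (U ⊗ₖ V)) =
      U.conjTranspose * ptraceRight ρ * U := by
  have hV' : ∀ b b', ∑ j, V b j * star (V b' j) = if b = b' then 1 else 0 := fun b b' => by
    simpa [Matrix.mul_apply, Matrix.one_apply] using congrFun (congrFun hV b) b'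
  ext i i'
  simp only [ptraceRight, Matrix.mul_apply, Matrix.conjTranspose_apply, Matrix.kroneckerMap_apply,
    Finset.sum_mul, Finset.mul_sum, star_mul']
  rw [Finset.sum_comm]
  simp_rw [Fintype.sum_prod_type]
  refine Finset.sum_congr rfl fun a' _ => ?_
  calc ∑ b', ∑ j, ∑ a, ∑ b, star (U a i) * star (V b j) * ρ (a, b) (a', b') * (U a' i' * V b' j)
      = ∑ b', ∑ a, ∑ b, star (U a i) * ρ (a, b) (a', b') * U a' i' *
          ∑ j, V b' j * star (V b j) := by
        refine Finset.sum_congr rfl fun b' _ => ?_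
        rw [Finset.sum_comm]
        refine Finset.sum_congr rfl fun a _ => ?_
        rw [Finset.sum_comm]
        refine Finset.sum_congr rfl fun b _ => ?_
        rw [Finset.mul_sum]
        exact Finset.sum_congr rfl fun j _ => by ring
    _ = _ := by
        simp_rw [hV']
        simp only [mul_ite, mul_one, mul_zero, Finset.sum_ite_eq, Finset.mem_univ, if_true]
        exact Finset.sum_comm

lemma ptraceLeft_kronecker_conj [Fintype A] [Fintype B] [DecidableEq A]
    (ρ : Matrix (A × B) (A × B) ℂ)
    {U : Matrix A A ℂ} (hU : U * U.conjTranspose = 1) (V : Matrix B B ℂ) :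
    ptraceLeft ((U ⊗ₖ V).conjTranspose * ρ * (U ⊗ₖ V)) =
      V.conjTranspose * ptraceLeft ρ * V := by
  rw [ptraceLeft_eq_ptraceRight, ptraceLeft_eq_ptraceRight, ← ptraceRight_kronecker_conj _ V hU]
  congr 1
  ext ⟨b, a⟩ ⟨b', a'⟩
  simp only [Matrix.reindex_apply, Matrix.submatrix_apply, Matrix.mul_apply,
    Matrix.conjTranspose_apply, Matrix.kroneckerMap_apply, Equiv.prodComm_symm,
    Equiv.prodComm_apply, Prod.swap_prod_mk]
  refine Fintype.sum_equiv (Equiv.prodComm A B) _ _ fun k => ?_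
  congr 1
  · refine Fintype.sum_equiv (Equiv.prodComm A B) _ _ fun l => ?_
    simp [mul_comm]
  · simp [mul_comm]

lemma conjTranspose_eigenvectorUnitary_mul_mul [Fintype A] [DecidableEq A] {σ : Matrix A A ℂ}
    (h : σ.IsHermitian) :
    (h.eigenvectorUnitary : Matrix A A ℂ).conjTranspose * σ * h.eigenvectorUnitary =
      Matrix.diagonal fun i => (h.eigenvalues i : ℂ) := by
  have := h.conjStarAlgAut_star_eigenvectorUnitary
  rw [Unitary.conjStarAlgAut_star_apply] at this
  exact this

/-- Audenaert's subadditivity of the Schatten norm deficit: `‖ρ_A‖_q + ‖ρ_B‖_q ≤ 1 + ‖ρ‖_q`. -/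
theorem schattenNorm_ptrace_add_le [Fintype A] [Fintype B]
    {ρ : Matrix (A × B) (A × B) ℂ} (h : ρ.PosSemidef)
    (htr : ρ.trace = 1) {q : ℝ} (hq : 1 ≤ q) :
    trRpow (ptraceRight ρ) q ^ (1 / q) + trRpow (ptraceLeft ρ) q ^ (1 / q) ≤
      1 + trRpow ρ q ^ (1 / q) := by
  classical
  have hA := (posSemidef_ptraceRight h).isHermitian
  have hB := (posSemidef_ptraceLeft h).isHermitian
  set U : Matrix A A ℂ := hA.eigenvectorUnitary.1
  set V : Matrix B B ℂ := hB.eigenvectorUnitary.1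
  have hU : U * U.conjTranspose = 1 := Unitary.coe_mul_star_self hA.eigenvectorUnitary
  have hV : V * V.conjTranspose = 1 := Unitary.coe_mul_star_self hB.eigenvectorUnitary
  have hUV : (U ⊗ₖ V) * (U ⊗ₖ V).conjTranspose = 1 := by
    rw [Matrix.conjTranspose_kronecker, ← Matrix.mul_kronecker_mul, hU, hV,
      Matrix.one_kronecker_one]
  set σ := (U ⊗ₖ V).conjTranspose * ρ * (U ⊗ₖ V) with hσ
  have hσpos : σ.PosSemidef := h.conjTranspose_mul_mul_same _
  have hσA : ptraceRight σ = Matrix.diagonal fun i => (hA.eigenvalues i : ℂ) := by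
    rw [hσ, ptraceRight_kronecker_conj ρ U hV, conjTranspose_eigenvectorUnitary_mul_mul]
  have hσB : ptraceLeft σ = Matrix.diagonal fun i => (hB.eigenvalues i : ℂ) := by
    rw [hσ, ptraceLeft_kronecker_conj ρ hU V, conjTranspose_eigenvectorUnitary_mul_mul]
  have hP : ∀ k, 0 ≤ (σ k k).re := fun k => (Complex.nonneg_iff.1 (hσpos.diag_nonneg)).1
  have hsum : ∑ k, (σ k k).re = 1 := by
    have : σ.trace = 1 := by
      rw [hσ, Matrix.trace_mul_comm, ← mul_assoc, hUV, one_mul, htr]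
    simpa [Matrix.trace] using congrArg Complex.re this
  have hmA : ∀ i, ∑ j, (σ (i, j) (i, j)).re = hA.eigenvalues i := fun i => by
    simpa [ptraceRight] using congrArg Complex.re (congrFun (congrFun hσA i) i)
  have hmB : ∀ j, ∑ i, (σ (i, j) (i, j)).re = hB.eigenvalues j := fun j => by
    simpa [ptraceLeft] using congrArg Complex.re (congrFun (congrFun hσB j) j)
  have hcl := lpNorm_marginals_add_le hq (fun k => (σ k k).re) hP hsum
  simp only [hmA, hmB] at hcl
  rw [trRpow_eq_sum_eigenvalues hA, trRpow_eq_sum_eigenvalues hB]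
  refine hcl.trans (add_le_add le_rfl (Real.rpow_le_rpow ?_ ?_ (by positivity)))
  · exact Finset.sum_nonneg fun k _ => Real.rpow_nonneg (hP k) _
  · rw [← trRpow_unitary_conj h.isHermitian hUV q]
    exact sum_diag_rpow_le_trRpow hσpos hq

/-- Subadditivity of `1 - (Tr σ^q)^s`. -/
theorem trRpow_rpow_ptrace_add_le [Fintype A] [Fintype B]
    {ρ : Matrix (A × B) (A × B) ℂ} (h : ρ.PosSemidef)
    (htr : ρ.trace = 1) {q s : ℝ} (hq : 1 ≤ q) (hqs : 1 ≤ q * s) :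
    trRpow (ptraceRight ρ) q ^ s + trRpow (ptraceLeft ρ) q ^ s ≤ 1 + trRpow ρ q ^ s := by
  have hA := posSemidef_ptraceRight h
  have hB := posSemidef_ptraceLeft h
  have htrA : (ptraceRight ρ).trace = 1 := by rw [trace_ptraceRight, htr]
  have htrB : (ptraceLeft ρ).trace = 1 := by rw [trace_ptraceLeft, htr]
  have hq0 : q ≠ 0 := by linarith
  have key : ∀ {x : ℝ}, 0 ≤ x → x ^ s = (x ^ (1 / q)) ^ (q * s) := fun hx => by
    rw [← Real.rpow_mul hx]
    congr 1
    field_simp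
  have hA0 := trRpow_nonneg hA q
  have hB0 := trRpow_nonneg hB q
  have h0 := trRpow_nonneg h q
  rw [key hA0, key hB0, key h0]
  have hq' : 0 ≤ 1 / q := by positivity
  exact rpow_add_rpow_le_one_add_rpow hqs (Real.rpow_nonneg hA0 _)
    (Real.rpow_le_one hA0 (trRpow_le_one hA htrA hq) hq') (Real.rpow_nonneg hB0 _)
    (Real.rpow_le_one hB0 (trRpow_le_one hB htrB hq) hq') (Real.rpow_nonneg h0 _)
    (schattenNorm_ptrace_add_le h htr hq)

/-- The Araki–Lieb type inequality, by purification. -/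
theorem trRpow_rpow_ptraceRight_add_le [Fintype A] [Fintype B]
    {ρ : Matrix (A × B) (A × B) ℂ} (h : ρ.PosSemidef)
    (htr : ρ.trace = 1) {q s : ℝ} (hq : 1 ≤ q) (hqs : 1 ≤ q * s) :
    trRpow (ptraceRight ρ) q ^ s + trRpow ρ q ^ s ≤ 1 + trRpow (ptraceLeft ρ) q ^ s := by
  classical
  have hq0 : q ≠ 0 := by linarith
  obtain ⟨M, hM⟩ : ∃ M : Matrix (A × B) (A × B) ℂ, ρ = M.conjTranspose * M :=
    CStarAlgebra.nonneg_iff_eq_star_mul_self.1 h.nonneg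
  let N : Matrix B (A × (A × B)) ℂ := fun b k => M k.2 (k.1, b)
  have hN : ∀ b k, N b k = M k.2 (k.1, b) := fun _ _ => rfl
  have hR : ptraceRight (N.conjTranspose * N) = ptraceRight ρ := by
    rw [hM]
    ext a a'
    simp only [ptraceRight, Matrix.mul_apply, Matrix.conjTranspose_apply, hN]
    exact Finset.sum_comm
  have hL : ptraceLeft (N.conjTranspose * N) = (M * M.conjTranspose).transpose := by
    ext c c'
    simp only [ptraceLeft, Matrix.mul_apply, Matrix.conjTranspose_apply, hN,
      Matrix.transpose_apply, Fintype.sum_prod_type, mul_comm]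
  have hT : ptraceLeft ρ = (N * N.conjTranspose).transpose := by
    rw [hM]
    ext b b'
    simp only [ptraceLeft, Matrix.mul_apply, Matrix.conjTranspose_apply, hN,
      Matrix.transpose_apply, Fintype.sum_prod_type, mul_comm]
  have htrN : (N.conjTranspose * N).trace = 1 := by
    rw [← trace_ptraceRight, hR, trace_ptraceRight, htr]
  have key := trRpow_rpow_ptrace_add_le (Matrix.posSemidef_conjTranspose_mul_self N) htrN hq hqs
  rw [hR, hL, trRpow_transpose (Matrix.isHermitian_mul_conjTranspose_self M),
    trRpow_mul_conjTranspose M hq0, ← hM, ← trRpow_mul_conjTranspose N hq0] at key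
  rwa [hT, trRpow_transpose (Matrix.isHermitian_mul_conjTranspose_self N)]

end PartialTrace

/-- Subadditivity and the triangle (Araki–Lieb type) inequality for
`F_{q,s}(σ) = 1 - (Tr σ^q)^s` on a bipartite density matrix. -/
theorem stmt4 {A B : Type*} [Fintype A] [Fintype B]
    (q s : ℝ) (hq : 1 ≤ q) (hqs : 1 ≤ q * s)
    (ρ : Matrix (A × B) (A × B) ℂ) (hpsd : ρ.PosSemidef) (htr : ρ.trace = 1) :
    |(1 - trRpow (ptraceRight ρ) q ^ s) - (1 - trRpow (ptraceLeft ρ) q ^ s)| ≤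
        1 - trRpow ρ q ^ s ∧
      1 - trRpow ρ q ^ s ≤
        (1 - trRpow (ptraceRight ρ) q ^ s) + (1 - trRpow (ptraceLeft ρ) q ^ s) := by
  have hsub := trRpow_rpow_ptrace_add_le hpsd htr hq hqs
  have hAL := trRpow_rpow_ptraceRight_add_le hpsd htr hq hqs
  have hLA := trRpow_rpow_ptraceRight_add_le
    (ρ := Matrix.reindex (Equiv.prodComm A B) (Equiv.prodComm A B) ρ) (hpsd.submatrix _)
    (by rw [← trace_ptraceRight, ← ptraceLeft_eq_ptraceRight, trace_ptraceLeft, htr]) hq hqs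
  rw [trRpow_reindex _ hpsd.isHermitian, ← ptraceLeft_eq_ptraceRight,
    show ptraceLeft (Matrix.reindex (Equiv.prodComm A B) (Equiv.prodComm A B) ρ) =
      ptraceRight ρ from rfl] at hLA
  refine ⟨abs_le.2 ⟨?_, ?_⟩, ?_⟩ <;> linarith
end

section
/- Let q ≥ 1 and qs ≥ 1, and define F_{q,s}(σ) = 1 − (Tr σ^q)^s for a density matrix σ. Let ρ be a density matrix indexed by (Π_{k=1}^n A_k) × (Π_{k=1}^n A_k) for finite index types A_1, …, A_n, and for each k let ρ_k denote the k-th single-site marginal of ρ (the partial trace over all factors except the k-th). Then F_{q,s}(ρ) ≤ Σ_{k=1}^n F_{q,s}(ρ_k). -/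
open scoped ComplexOrder

/-- The `k`-th single-site marginal of a multipartite matrix: partial trace
over all tensor factors except the `k`-th. -/
noncomputable def marginal {n : ℕ} {A : Fin n → Type*} [∀ k, Fintype (A k)]
    (ρ : Matrix (∀ k, A k) (∀ k, A k) ℂ) (k : Fin n) : Matrix (A k) (A k) ℂ :=
  fun a a' => ∑ b : ∀ j : {j // j ≠ k}, A j,
    ρ (fun j => if h : j = k then cast (congrArg A h.symm) a else b ⟨j, h⟩)
      (fun j => if h : j = k then cast (congrArg A h.symm) a' else b ⟨j, h⟩)

/-- The Weierstrass product inequality. -/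
theorem one_sub_sum_le_prod {ι : Type*} (S : Finset ι) (y : ι → ℝ)
    (h0 : ∀ i ∈ S, 0 ≤ y i) (h1 : ∀ i ∈ S, y i ≤ 1) :
    1 - ∑ i ∈ S, (1 - y i) ≤ ∏ i ∈ S, y i := by
  classical
  induction S using Finset.induction_on with
  | empty => simp
  | insert i S hi ih =>
    simp only [Finset.forall_mem_insert] at h0 h1
    rw [Finset.sum_insert hi, Finset.prod_insert hi]
    have hP : ∏ j ∈ S, y j ≤ 1 := Finset.prod_le_one h0.2 h1.2
    nlinarith [ih h0.2 h1.2, mul_nonneg (sub_nonneg.2 h1.1) (sub_nonneg.2 hP)]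

theorem rpow_add_rpow_le_one_add_rpow_s16 {a c r : ℝ} (hc : 0 ≤ c) (hca : c ≤ a) (ha : a ≤ 1)
    (hr : 1 ≤ r) : a ^ r + (c + (1 - a)) ^ r ≤ 1 + c ^ r := by
  rcases (hca.trans ha).eq_or_lt with rfl | hlt
  · obtain rfl := le_antisymm ha hca
    simp
  have hd : 0 < 1 - c := by linarith
  have hconv := convexOn_rpow hr
  set t := (a - c) / (1 - c) with ht
  have htd : t * (1 - c) = a - c := div_mul_cancel₀ _ hd.ne'
  have ht0 : 0 ≤ t := div_nonneg (by linarith) hd.le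
  have ht1 : 0 ≤ 1 - t := by
    rw [sub_nonneg, ht, div_le_one hd]
    linarith
  have h1 := hconv.2 (Set.mem_Ici.2 zero_le_one) (Set.mem_Ici.2 hc) ht0 ht1 (by ring)
  have h2 := hconv.2 (Set.mem_Ici.2 zero_le_one) (Set.mem_Ici.2 hc) ht1 ht0 (by ring)
  simp only [smul_eq_mul, Real.one_rpow, mul_one] at h1 h2
  rw [show t + (1 - t) * c = a by linarith] at h1
  rw [show 1 - t + t * c = c + (1 - a) by linarith] at h2
  linarith

theorem one_sub_rpow_le_sum {ι : Type*} {r : ℝ} (hr : 1 ≤ r) (S : Finset ι) (a : ι → ℝ)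
    (h0 : ∀ i, 0 ≤ a i) (h1 : ∀ i, a i ≤ 1) (c : ℝ) (hc : 0 ≤ c)
    (h : 1 - c ≤ ∑ i ∈ S, (1 - a i)) : 1 - c ^ r ≤ ∑ i ∈ S, (1 - a i ^ r) := by
  classical
  have hr0 : 0 ≤ r := zero_le_one.trans hr
  induction S using Finset.induction_on generalizing c with
  | empty =>
    have := Real.one_le_rpow (show 1 ≤ c by simpa using h) hr0
    simpa using this
  | insert i S hi ih =>
    rw [Finset.sum_insert hi] at h ⊢
    rcases le_total c (a i) with hca | hac
    · have := ih (c + (1 - a i)) (by linarith [h1 i]) (by linarith)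
      linarith [rpow_add_rpow_le_one_add_rpow_s16 hc hca (h1 i) hr]
    · have hS : 0 ≤ ∑ j ∈ S, (1 - a j ^ r) :=
        Finset.sum_nonneg fun j _ => sub_nonneg.2 (Real.rpow_le_one (h0 j) (h1 j) hr0)
      linarith [Real.rpow_le_rpow (h0 i) hac hr0]

theorem sum_rpow_le_one {α : Type*} [Fintype α] {q : ℝ} (hq : 1 ≤ q) (m : α → ℝ)
    (hm : ∀ a, 0 ≤ m a) (hsum : ∑ a, m a = 1) : ∑ a, m a ^ q ≤ 1 := by
  rw [← hsum]
  refine Finset.sum_le_sum fun a _ => ?_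
  have h1 : m a ≤ 1 := hsum ▸ Finset.single_le_sum (fun b _ => hm b) (Finset.mem_univ a)
  exact Real.rpow_le_self_of_le_one (hm a) h1 hq

/-- The norming functional of a probability vector in `ℓ^q`. -/
theorem exists_norming_functional {α : Type*} [Fintype α] {q q' : ℝ} (hq : q.HolderConjugate q')
    (m : α → ℝ) (hm : ∀ a, 0 ≤ m a) (hsum : ∑ a, m a = 1) :
    ∃ y : α → ℝ, (∀ a, 0 ≤ y a) ∧ (∀ a, y a ≤ 1) ∧ ∑ a, y a ^ q' = 1 ∧
      ∑ a, m a * y a = (∑ a, m a ^ q) ^ (1 / q) := by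
  have hq0 : 0 < q := hq.pos
  have hT : 0 < ∑ a, m a ^ q := by
    obtain ⟨a, -, ha⟩ : ∃ a ∈ Finset.univ, m a ≠ 0 :=
      Finset.exists_ne_zero_of_sum_ne_zero (by rw [hsum]; exact one_ne_zero)
    exact Finset.sum_pos' (fun b _ => Real.rpow_nonneg (hm b) q)
      ⟨a, Finset.mem_univ a, Real.rpow_pos_of_pos ((hm a).lt_of_ne' ha) q⟩
  set N := (∑ a, m a ^ q) ^ (1 / q) with hN
  have hN0 : 0 < N := Real.rpow_pos_of_pos hT _
  have hNq : N ^ q = ∑ a, m a ^ q := by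
    rw [hN, ← Real.rpow_mul hT.le, one_div_mul_cancel hq0.ne', Real.rpow_one]
  have hl0 : ∀ a, 0 ≤ m a / N := fun a => div_nonneg (hm a) hN0.le
  have hlsum : ∑ a, (m a / N) ^ q = 1 := by
    simp_rw [Real.div_rpow (hm _) hN0.le, ← Finset.sum_div, hNq]
    exact div_self hT.ne'
  have hl1 : ∀ a, m a / N ≤ 1 := fun a => by
    have : (m a / N) ^ q ≤ 1 := hlsum ▸ Finset.single_le_sum
      (fun b _ => Real.rpow_nonneg (hl0 b) q) (Finset.mem_univ a)
    by_contra! hgt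
    exact this.not_gt (Real.one_lt_rpow hgt hq0)
  refine ⟨fun a => (m a / N) ^ (q - 1), fun a => Real.rpow_nonneg (hl0 a) _,
    fun a => Real.rpow_le_one (hl0 a) (hl1 a) hq.sub_one_pos.le, ?_, ?_⟩
  · simp_rw [← Real.rpow_mul (hl0 _), hq.sub_one_mul_conj]
    exact hlsum
  · have h : ∀ a, m a * (m a / N) ^ (q - 1) = N * (m a / N) ^ q := fun a => by
      have h2 : (m a / N) ^ q = m a / N * (m a / N) ^ (q - 1) := by
        rw [← Real.rpow_one_add' (hl0 a) (by linarith)]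
        congr 1
        ring
      rw [h2, ← mul_assoc, mul_div_cancel₀ _ hN0.ne']
    simp_rw [h, ← Finset.mul_sum, hlsum, mul_one]

/-- Subadditivity of `1 - ‖p‖_q` over the marginals of a joint probability distribution. -/
theorem one_sub_norm_le_sum_marginals {ι : Type*} [Fintype ι] [DecidableEq ι] {A : ι → Type*}
    [∀ k, Fintype (A k)] {q : ℝ} (hq : 1 ≤ q) (p : (∀ k, A k) → ℝ)
    (hp : ∀ I, 0 ≤ p I) (hsum : ∑ I, p I = 1) (m : ∀ k, A k → ℝ)
    (hm : ∀ k (f : A k → ℝ), ∑ I, p I * f (I k) = ∑ a, m k a * f a)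
    (hm0 : ∀ k a, 0 ≤ m k a) :
    1 - (∑ I, p I ^ q) ^ (1 / q) ≤ ∑ k, (1 - (∑ a, m k a ^ q) ^ (1 / q)) := by
  have hm1 : ∀ k, ∑ a, m k a = 1 := fun k => by
    have := hm k fun _ => 1
    simp only [mul_one] at this
    rw [← this, hsum]
  rcases hq.eq_or_lt with rfl | hq1
  · simp [hm1, hsum]
  have hqq := Real.HolderConjugate.conjExponent hq1
  set q' := q.conjExponent
  choose y hy0 hy1 hyq hym using fun k => exists_norming_functional hqq (m k) (hm0 k) (hm1 k)
  have hholder := Real.inner_le_Lp_mul_Lq_of_nonneg (s := Finset.univ) (f := p)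
    (g := fun I => ∏ k, y k (I k)) hqq (fun I _ => hp I)
    (fun I _ => Finset.prod_nonneg fun k _ => hy0 k _)
  have hprod : ∑ I : ∀ k, A k, (∏ k, y k (I k)) ^ q' = 1 := by
    simp_rw [← Real.finsetProd_rpow _ _ fun k _ => hy0 k _]
    rw [← Fintype.prod_sum fun k a => y k a ^ q']
    simp [hyq]
  rw [hprod, Real.one_rpow, mul_one] at hholder
  refine (sub_le_sub_left hholder 1).trans ?_
  have hlow : ∑ I, p I * (1 - ∑ k, (1 - y k (I k))) ≤ ∑ I, p I * ∏ k, y k (I k) :=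
    Finset.sum_le_sum fun I _ => mul_le_mul_of_nonneg_left
      (one_sub_sum_le_prod _ _ (fun k _ => hy0 k _) fun k _ => hy1 k _) (hp I)
  have heq : ∑ I, p I * (1 - ∑ k, (1 - y k (I k))) =
      1 - ∑ k, (1 - (∑ a, m k a ^ q) ^ (1 / q)) := by
    have hk : ∀ k, ∑ I, p I * (1 - y k (I k)) = 1 - (∑ a, m k a ^ q) ^ (1 / q) := fun k => by
      rw [hm k fun a => 1 - y k a, ← hym k]
      simp_rw [mul_sub, mul_one, Finset.sum_sub_distrib, hm1]
    simp_rw [← hk]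
    rw [Finset.sum_comm]
    simp_rw [← Finset.mul_sum]
    simp_rw [mul_one_sub, Finset.sum_sub_distrib, hsum]
  linarith

open Matrix in
theorem Matrix.IsHermitian.star_eigenvectorUnitary_mul_mul {n : Type*} [Fintype n] [DecidableEq n]
    {ρ : Matrix n n ℂ} (h : ρ.IsHermitian) :
    star (h.eigenvectorUnitary : Matrix n n ℂ) * ρ * (h.eigenvectorUnitary : Matrix n n ℂ) =
      diagonal (fun i => (h.eigenvalues i : ℂ)) := by
  have := h.conjStarAlgAut_star_eigenvectorUnitary
  rw [Unitary.conjStarAlgAut_star_apply] at this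
  exact this

theorem trRpow_eq_sum {n : Type*} [Fintype n] [DecidableEq n] {ρ : Matrix n n ℂ}
    (h : ρ.IsHermitian) (r : ℝ) : trRpow ρ r = ∑ i, h.eigenvalues i ^ r := by
  unfold trRpow
  rw [dif_pos h]
  congr!

/-- The diagonal of a positive semidefinite matrix in any orthonormal basis is majorized by its
spectrum, so its `q`-power sum is at most that of the spectrum. -/
theorem sum_diag_rpow_le_trRpow_s16 {n : Type*} [Fintype n] [DecidableEq n] {ρ : Matrix n n ℂ}
    (hρ : ρ.PosSemidef) {V : Matrix n n ℂ} (hV : V ∈ Matrix.unitaryGroup n ℂ) {q : ℝ}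
    (hq : 1 ≤ q) : ∑ i, ((star V * ρ * V) i i).re ^ q ≤ trRpow ρ q := by
  rw [trRpow_eq_sum hρ.1]
  set E : Matrix.unitaryGroup n ℂ := hρ.1.eigenvectorUnitary with hE
  set l := hρ.1.eigenvalues
  set W : Matrix.unitaryGroup n ℂ := star ⟨V, hV⟩ * E
  have hWV : (W : Matrix n n ℂ) = star V * E := rfl
  have hdiag : star V * ρ * V =
      W * Matrix.diagonal (fun i => (l i : ℂ)) * star (W : Matrix n n ℂ) := by
    rw [← hρ.1.star_eigenvectorUnitary_mul_mul, hWV, ← hE, star_mul, star_star]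
    have h1 : (E : Matrix n n ℂ) * star (E : Matrix n n ℂ) = 1 := Matrix.mem_unitaryGroup_iff.1 E.2
    calc star V * ρ * V = star V * (E * star (E : Matrix n n ℂ)) * ρ *
          (E * star (E : Matrix n n ℂ)) * V := by simp [h1]
      _ = _ := by simp only [mul_assoc]
  have hentry : ∀ i, ((star V * ρ * V) i i).re =
      ∑ j, Complex.normSq ((W : Matrix n n ℂ) i j) * l j := by
    intro i
    rw [hdiag, Matrix.mul_apply, Complex.re_sum]
    refine Finset.sum_congr rfl fun j _ => ?_
    rw [Matrix.mul_diagonal, Matrix.star_apply, mul_right_comm, Complex.star_def,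
      Complex.mul_conj, ← Complex.ofReal_mul, Complex.ofReal_re]
  have hrow : ∀ i, ∑ j, Complex.normSq ((W : Matrix n n ℂ) i j) = 1 := fun i => by
    have := congrFun₂ (Matrix.mem_unitaryGroup_iff.1 W.2) i i
    simp only [Matrix.mul_apply, Matrix.star_apply, Complex.star_def, Complex.mul_conj,
      Matrix.one_apply_eq] at this
    exact_mod_cast this
  have hcol : ∀ j, ∑ i, Complex.normSq ((W : Matrix n n ℂ) i j) = 1 := fun j => by
    have := congrFun₂ (Matrix.mem_unitaryGroup_iff'.1 W.2) j j
    simp only [Matrix.mul_apply, Matrix.star_apply, Complex.star_def, mul_comm, Complex.mul_conj,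
      Matrix.one_apply_eq] at this
    exact_mod_cast this
  calc ∑ i, ((star V * ρ * V) i i).re ^ q
      ≤ ∑ i, ∑ j, Complex.normSq ((W : Matrix n n ℂ) i j) * l j ^ q := by
        refine Finset.sum_le_sum fun i _ => ?_
        rw [hentry]
        exact Real.rpow_arith_mean_le_arith_mean_rpow _ _ _ (fun j _ => Complex.normSq_nonneg _)
          (hrow i) (fun j _ => hρ.eigenvalues_nonneg j) hq
    _ = ∑ j, l j ^ q := by
        rw [Finset.sum_comm]
        simp_rw [← Finset.sum_mul, hcol, one_mul]

theorem marginal_isHermitian {n : ℕ} {A : Fin n → Type*} [∀ k, Fintype (A k)]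
    {ρ : Matrix (∀ k, A k) (∀ k, A k) ℂ} (h : ρ.IsHermitian) (k : Fin n) :
    (marginal ρ k).IsHermitian := by
  ext a a'
  simp only [marginal, Matrix.conjTranspose_apply, star_sum]
  exact Finset.sum_congr rfl fun b _ => h.apply _ _

theorem sum_marginal_mul {n : ℕ} {A : Fin n → Type*} [∀ k, Fintype (A k)]
    [∀ k, DecidableEq (A k)] (ρ : Matrix (∀ k, A k) (∀ k, A k) ℂ) (k : Fin n)
    (f : A k → A k → ℂ) :
    ∑ i, ∑ i', ρ i i' * (f (i k) (i' k) *
        ∏ j : {j // j ≠ k}, (1 : Matrix (A j) (A j) ℂ) (i j) (i' j)) =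
      ∑ a, ∑ a', marginal ρ k a a' * f a a' := by
  have hsymm : ∀ (a : A k) (b : ∀ j : {j // j ≠ k}, A j),
      (Equiv.piSplitAt k A).symm (a, b) =
        fun j => if h : j = k then cast (congrArg A h.symm) a else b ⟨j, h⟩ := fun a b => by
    ext j
    by_cases h : j = k
    · subst h
      simp [Equiv.piSplitAt]
    · simp [Equiv.piSplitAt, h]
  have hk : ∀ (a : A k) (b : ∀ j : {j // j ≠ k}, A j),
      (Equiv.piSplitAt k A).symm (a, b) k = a := fun a b => by simp
  have hne : ∀ (a : A k) (b : ∀ j : {j // j ≠ k}, A j) (j : {j // j ≠ k}),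
      (Equiv.piSplitAt k A).symm (a, b) j = b j := fun a b j => by simp [j.2]
  have hdelta : ∀ b b' : ∀ j : {j // j ≠ k}, A j,
      ∏ j : {j // j ≠ k}, (1 : Matrix (A j.1) (A j.1) ℂ) (b j) (b' j) = if b = b' then 1 else 0 :=
    fun b b' => by
    simp only [Matrix.one_apply, Finset.prod_ite_zero, Finset.prod_const_one, funext_iff,
      Finset.mem_univ, true_imp_iff]
  have hsplit : ∀ F : (∀ j, A j) → ℂ,
      ∑ i, F i = ∑ a, ∑ b, F ((Equiv.piSplitAt k A).symm (a, b)) := fun F => by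
    rw [← (Equiv.piSplitAt k A).symm.sum_comp, Fintype.sum_prod_type]
  simp only [hsplit, hk, hne, hdelta]
  refine Finset.sum_congr rfl fun a _ => ?_
  rw [Finset.sum_comm]
  refine Finset.sum_congr rfl fun a' _ => ?_
  simp only [marginal, Finset.sum_mul, mul_ite, mul_one, mul_zero, Finset.sum_ite_eq,
    Finset.mem_univ, if_true, hsymm]

/-- The tensor product of a family of square matrices. -/
def Matrix.piTensor {ι : Type*} [Fintype ι] {A : ι → Type*} (U : ∀ k, Matrix (A k) (A k) ℂ) :
    Matrix (∀ k, A k) (∀ k, A k) ℂ :=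
  fun i I => ∏ k, U k (i k) (I k)

theorem Matrix.piTensor_mem_unitaryGroup {ι : Type*} [Fintype ι] [DecidableEq ι] {A : ι → Type*}
    [∀ k, Fintype (A k)] [∀ k, DecidableEq (A k)] (U : ∀ k, Matrix.unitaryGroup (A k) ℂ) :
    Matrix.piTensor (fun k => (U k : Matrix (A k) (A k) ℂ)) ∈
      Matrix.unitaryGroup (∀ k, A k) ℂ := by
  rw [Matrix.mem_unitaryGroup_iff]
  ext i i'
  have h : ∀ k, ∑ x, (U k : Matrix (A k) (A k) ℂ) (i k) x *
      star ((U k : Matrix (A k) (A k) ℂ) (i' k) x) = if i k = i' k then 1 else 0 := fun k => by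
    have := congrFun₂ (Matrix.mem_unitaryGroup_iff.1 (U k).2) (i k) (i' k)
    simpa only [Matrix.mul_apply, Matrix.star_apply, Matrix.one_apply] using this
  simp only [Matrix.mul_apply, Matrix.star_apply, Matrix.piTensor, star_prod,
    ← Finset.prod_mul_distrib]
  rw [← Fintype.prod_sum fun k x => (U k : Matrix (A k) (A k) ℂ) (i k) x *
      star ((U k : Matrix (A k) (A k) ℂ) (i' k) x)]
  simp only [h, Matrix.one_apply, Finset.prod_ite_zero, Finset.prod_const_one, funext_iff,
      Finset.mem_univ, true_imp_iff]

theorem Matrix.sum_diag_star_mul_mul {m : Type*} [Fintype m] (ρ V : Matrix m m ℂ) (g : m → ℂ) :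
    ∑ I, (star V * ρ * V) I I * g I =
      ∑ i, ∑ i', ρ i i' * ∑ I, g I * (star (V i I) * V i' I) := by
  simp only [Matrix.mul_apply, Matrix.star_apply, Finset.sum_mul, Finset.mul_sum]
  rw [Finset.sum_comm]
  conv_rhs => rw [Finset.sum_comm]
  refine Finset.sum_congr rfl fun i' _ => ?_
  rw [Finset.sum_comm]
  exact Finset.sum_congr rfl fun i _ => Finset.sum_congr rfl fun I _ => by ring

/-- The diagonal of `ρ` in a product basis has as its marginals the diagonals of the marginals
of `ρ`. -/
theorem sum_diag_piTensor_mul {n : ℕ} {A : Fin n → Type*} [∀ k, Fintype (A k)]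
    [∀ k, DecidableEq (A k)] (ρ : Matrix (∀ k, A k) (∀ k, A k) ℂ)
    (U : ∀ k, Matrix.unitaryGroup (A k) ℂ) (k : Fin n) (f : A k → ℂ) :
    ∑ I, (star (Matrix.piTensor fun k => (U k : Matrix (A k) (A k) ℂ)) * ρ *
        Matrix.piTensor fun k => (U k : Matrix (A k) (A k) ℂ)) I I * f (I k) =
      ∑ a, (star (U k : Matrix (A k) (A k) ℂ) * marginal ρ k *
        (U k : Matrix (A k) (A k) ℂ)) a a * f a := by
  set u : ∀ k, Matrix (A k) (A k) ℂ := fun k => U k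
  have hU : ∀ j (a a' : A j),
      ∑ x, star (u j a x) * u j a' x = (1 : Matrix (A j) (A j) ℂ) a a' := by
    intro j a a'
    have := congrFun₂ (Matrix.mem_unitaryGroup_iff.1 (U j).2) a' a
    simp only [Matrix.mul_apply, Matrix.star_apply] at this
    simp_rw [mul_comm (star _)]
    rw [show (1 : Matrix (A j) (A j) ℂ) a a' = (1 : Matrix (A j) (A j) ℂ) a' a by
      simp only [Matrix.one_apply, eq_comm]]
    exact this
  have hinner : ∀ i i' : ∀ k, A k, ∑ I : ∀ k, A k, f (I k) *
      (star (Matrix.piTensor u i I) * Matrix.piTensor u i' I) =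
      (∑ x, f x * (star (u k (i k) x) * u k (i' k) x)) *
        ∏ j : {j // j ≠ k}, (1 : Matrix (A j) (A j) ℂ) (i j) (i' j) := by
    intro i i'
    set w : ∀ j, A j → ℂ := Function.update (fun _ _ => 1) k f
    have hwk : w k = f := Function.update_self ..
    have hwj : ∀ j : {j // j ≠ k}, w j = fun _ => 1 := fun j => Function.update_of_ne j.2 ..
    have hf : ∀ I : ∀ k, A k, f (I k) = ∏ j, w j (I j) := fun I => by
      rw [Fintype.prod_eq_mul_prod_subtype_ne _ k, hwk]
      simp [hwj]
    simp only [hf, Matrix.piTensor, star_prod, ← Finset.prod_mul_distrib]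
    rw [← Fintype.prod_sum fun j x => w j x * (star (u j (i j) x) * u j (i' j) x),
      Fintype.prod_eq_mul_prod_subtype_ne _ k, hwk]
    simp only [hwj, one_mul, hU]
  rw [Matrix.sum_diag_star_mul_mul ρ (Matrix.piTensor u) fun I => f (I k),
    Matrix.sum_diag_star_mul_mul (marginal ρ k) (u k) f, ← sum_marginal_mul]
  simp only [hinner]

/-- Subadditivity of `F_{q,s}(σ) = 1 - (Tr σ^q)^s` over the single-site
marginals of a multipartite density matrix, for `q ≥ 1`, `qs ≥ 1`. -/
theorem stmt16 (q s : ℝ) (hq : 1 ≤ q) (hqs : 1 ≤ q * s)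
    (n : ℕ) (A : Fin n → Type*) [∀ k, Fintype (A k)]
    (ρ : Matrix (∀ k, A k) (∀ k, A k) ℂ)
    (hpsd : ρ.PosSemidef) (htr : ρ.trace = 1) :
    1 - trRpow ρ q ^ s ≤ ∑ k, (1 - trRpow (marginal ρ k) q ^ s) := by
  classical
  have hq0 : 0 < q := by linarith
  have hs : 0 ≤ s := by
    by_contra! hs
    nlinarith
  have hmh := fun k => marginal_isHermitian hpsd.1 k
  set U : ∀ k, Matrix.unitaryGroup (A k) ℂ := fun k => (hmh k).eigenvectorUnitary
  set V := Matrix.piTensor fun k => (U k : Matrix (A k) (A k) ℂ)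
  have hV : V ∈ Matrix.unitaryGroup (∀ k, A k) ℂ := Matrix.piTensor_mem_unitaryGroup U
  have hD : (star V * ρ * V).PosSemidef := hpsd.conjTranspose_mul_mul_same V
  set p : (∀ k, A k) → ℝ := fun I => ((star V * ρ * V) I I).re
  have hp0 : ∀ I, 0 ≤ p I := fun I => (Complex.nonneg_iff.1 hD.diag_nonneg).1
  have hpC : ∀ I, (star V * ρ * V) I I = p I := fun I =>
    Complex.ext rfl (Complex.nonneg_iff.1 hD.diag_nonneg).2.symm
  have hsum : ∑ I, p I = 1 := by
    have : (star V * ρ * V).trace = 1 := by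
      rw [Matrix.trace_mul_cycle, Matrix.mem_unitaryGroup_iff.1 hV, one_mul, htr]
    simp only [Matrix.trace, Matrix.diag_apply, hpC] at this
    exact_mod_cast this
  have hm : ∀ k (f : A k → ℝ),
      ∑ I, p I * f (I k) = ∑ a, (hmh k).eigenvalues a * f a := fun k f => by
    have := sum_diag_piTensor_mul ρ U k fun a => (f a : ℂ)
    rw [(hmh k).star_eigenvectorUnitary_mul_mul] at this
    simp only [Matrix.diagonal_apply_eq] at this
    simp_rw [show ∀ I, (star (Matrix.piTensor fun k => (U k : Matrix (A k) (A k) ℂ)) * ρ *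
        Matrix.piTensor fun k => (U k : Matrix (A k) (A k) ℂ)) I I = p I from hpC] at this
    exact_mod_cast this
  have hm0 : ∀ k a, 0 ≤ (hmh k).eigenvalues a := fun k a => by
    have := hm k (Pi.single a 1)
    simp only [Pi.single_apply, mul_ite, mul_one, mul_zero, Finset.sum_ite_eq',
      Finset.mem_univ, if_true] at this
    rw [← this]
    exact Finset.sum_nonneg fun I _ => by
      split_ifs
      exacts [hp0 I, le_rfl]
  have hm1 : ∀ k, ∑ a, (hmh k).eigenvalues a = 1 := fun k => by
    have := hm k fun _ => 1
    simp only [mul_one] at this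
    rw [← this, hsum]
  have hnorm := one_sub_norm_le_sum_marginals hq p hp0 hsum (fun k => (hmh k).eigenvalues) hm hm0
  have hT0 : ∀ k, 0 ≤ ∑ a, (hmh k).eigenvalues a ^ q := fun k =>
    Finset.sum_nonneg fun a _ => Real.rpow_nonneg (hm0 k a) q
  have hP0 : 0 ≤ ∑ I, p I ^ q := Finset.sum_nonneg fun I _ => Real.rpow_nonneg (hp0 I) q
  have hpow : ∀ T : ℝ, 0 ≤ T → (T ^ (1 / q)) ^ (q * s) = T ^ s := fun T hT => by
    rw [← Real.rpow_mul hT, ← mul_assoc, one_div_mul_cancel hq0.ne', one_mul]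
  have hfinal := one_sub_rpow_le_sum hqs Finset.univ _ (fun k => Real.rpow_nonneg (hT0 k) (1 / q))
    (fun k => Real.rpow_le_one (hT0 k) (sum_rpow_le_one hq _ (hm0 k) (hm1 k)) (by positivity))
    _ (Real.rpow_nonneg hP0 _) hnorm
  simp only [hpow _ (hT0 _), hpow _ hP0] at hfinal
  simp_rw [trRpow_eq_sum (hmh _)]
  exact (sub_le_sub_left (Real.rpow_le_rpow hP0 (sum_diag_rpow_le_trRpow_s16 hpsd hV hq) hs) 1).trans
    hfinal
end
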